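/- arXiv:2301.06904 — 2 statements merged into one kernel-verified Lean document; each statement's English description precedes it below -/
import Mathlib

section
/- ∑_{n≥0} 1/(π²(n+1/2)² (π²(n+1/2)² − θ²)) = −(1/(2θ²))·(1 − tan(θ)/θ) for every complex θ ≠ 0 avoiding the poles π(n+1/2) of tan. -/
open Filter Topology in
/-- The partial fraction expansion of the tangent. -/
theorem hasSum_tan_pi_mul {x : ℂ} (hx : ∀ n : ℤ, x ≠ (n : ℂ) + 1 / 2) :
    HasSum (fun n : ℕ => 1 / (x - ((n : ℂ) + 1 / 2)) + 1 / (x + ((n : ℂ) + 1 / 2)))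
      (-((Real.pi : ℂ) * Complex.tan (Real.pi * x))) := by
  have hmem : x + 1 / 2 ∈ Complex.integerComplement := by
    rintro ⟨m, hm⟩
    apply hx (m - 1)
    push_cast
    linear_combination -hm
  have hadd (n : ℕ) : x + ((n : ℂ) + 1 / 2) ≠ 0 := by
    intro h
    apply hx (-n - 1)
    push_cast
    linear_combination h
  have hsub (n : ℕ) : x - ((n : ℂ) + 1 / 2) ≠ 0 := by
    intro h
    apply hx n
    push_cast
    linear_combination h
  have hsummable : Summable
      (fun n : ℕ => 1 / (x - ((n : ℂ) + 1 / 2)) + 1 / (x + ((n : ℂ) + 1 / 2))) := by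
    have hint : Summable fun n : ℤ => ((x - 1 / 2 - n) * (x + 1 / 2 + n))⁻¹ := by
      apply EisensteinSeries.summable_inv_of_isBigO_rpow_inv (a := 2) (by norm_cast)
      simpa [pow_two, sub_eq_add_neg] using!
        (EisensteinSeries.linear_inv_isBigO_right 1 (x + 1 / 2)).mul
          (EisensteinSeries.linear_inv_isBigO_right 1 (x - 1 / 2)).comp_neg_int
    have hnat := (hint.comp_injective (i := ((↑) : ℕ → ℤ)) Nat.cast_injective).mul_left (2 * x)
    refine hnat.congr fun n => ?_
    have h₁ : x - 1 / 2 - n ≠ 0 := by convert hsub n using 1; ring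
    have h₂ : x + 1 / 2 + n ≠ 0 := by convert hadd n using 1; ring
    rw [one_div_add_one_div (hsub n) (hadd n)]
    simp only [Function.comp_apply, Int.cast_natCast]
    rw [← div_eq_mul_inv]
    congr 1 <;> ring
  rw [hsummable.hasSum_iff_tendsto_nat]
  have hcot : Complex.cot (Real.pi * (x + 1 / 2)) = -Complex.tan (Real.pi * x) := by
    rw [Complex.cot_eq_cos_div_sin, Complex.tan_eq_sin_div_cos, mul_add, mul_one_div,
      Complex.cos_add_pi_div_two, Complex.sin_add_pi_div_two, neg_div]
  have hzero : Tendsto (fun n : ℕ => 1 / (x + 1 / 2 + n)) atTop (𝓝 0) := by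
    simpa using EisensteinSeries.tendsto_zero_inv_linear (x + 1 / 2) 1
  have hlim := ((tendsto_logDeriv_euler_cot_sub hmem).add_const (1 / (x + 1 / 2))).sub hzero
  rw [hcot, sub_add_cancel, sub_zero, mul_neg] at hlim
  refine hlim.congr fun N => ?_
  induction N with
  | zero => simp
  | succ N ih =>
    rw [Finset.sum_range_succ, Finset.sum_range_succ, ← ih, cotTerm]
    push_cast
    rw [show x + 1 / 2 - ((N : ℂ) + 1) = x - ((N : ℂ) + 1 / 2) by ring,
      show x + 1 / 2 + (N : ℂ) = x + ((N : ℂ) + 1 / 2) by ring]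
    ring

theorem hasSum_one_div_nat_add_half_sq :
    HasSum (fun n : ℕ => (1 : ℝ) / ((n : ℝ) + 1 / 2) ^ 2) (Real.pi ^ 2 / 2) := by
  have heven : HasSum (fun n : ℕ => (1 : ℝ) / ((2 * n : ℕ) : ℝ) ^ 2)
      (1 / 4 * (Real.pi ^ 2 / 6)) := by
    refine (hasSum_zeta_two.mul_left (1 / 4 : ℝ)).congr_fun fun n => ?_
    push_cast
    rw [mul_pow, one_div_mul_one_div]
    norm_num
  have hodd : Summable (fun n : ℕ => (1 : ℝ) / ((2 * n + 1 : ℕ) : ℝ) ^ 2) :=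
    hasSum_zeta_two.summable.comp_injective (i := fun n : ℕ => 2 * n + 1)
      fun a b h => by simpa using h
  have htotal := (heven.even_add_odd (f := fun n : ℕ => (1 : ℝ) / (n : ℝ) ^ 2)
    hodd.hasSum).unique hasSum_zeta_two
  have hvalue := hodd.hasSum.mul_left 4
  rw [show 4 * ∑' n : ℕ, (1 : ℝ) / ((2 * n + 1 : ℕ) : ℝ) ^ 2 = Real.pi ^ 2 / 2 by
    linarith] at hvalue
  refine hvalue.congr_fun fun n => ?_
  have : (n : ℝ) + 1 / 2 = (2 * n + 1) / 2 := by ring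
  push_cast
  rw [this, div_pow, one_div_div]
  ring

theorem stmt_14 (θ : ℂ) (hθ0 : θ ≠ 0)
    (hθ : ∀ n : ℤ, θ ≠ (Real.pi : ℂ) * ((n : ℂ) + 1 / 2)) :
    ∑' n : ℕ,
        1 / ((Real.pi : ℂ) ^ 2 * ((n : ℂ) + 1 / 2) ^ 2 *
          ((Real.pi : ℂ) ^ 2 * ((n : ℂ) + 1 / 2) ^ 2 - θ ^ 2)) =
      -(1 / (2 * θ ^ 2)) * (1 - Complex.tan θ / θ) := by
  have hpi : (Real.pi : ℂ) ≠ 0 := by exact_mod_cast Real.pi_ne_zero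
  have hx (n : ℤ) : θ / Real.pi ≠ (n : ℂ) + 1 / 2 := by
    rw [ne_eq, div_eq_iff hpi, mul_comm]
    exact hθ n
  have htan := (hasSum_tan_pi_mul hx).mul_left (-(1 / (2 * θ ^ 3 * Real.pi)))
  have hsq := (Complex.hasSum_ofReal.mpr hasSum_one_div_nat_add_half_sq).mul_left
    (1 / (θ ^ 2 * (Real.pi : ℂ) ^ 2))
  rw [mul_div_cancel₀ θ hpi] at htan
  have hsum := htan.sub hsq
  refine (hsum.congr_fun fun n => ?_).tsum_eq.trans ?_
  · have hhalf : (n : ℂ) + 1 / 2 ≠ 0 := by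
      have : (((n : ℝ) + 1 / 2 : ℝ) : ℂ) ≠ 0 := Complex.ofReal_ne_zero.mpr (by positivity)
      simpa using this
    have hsub : θ - Real.pi * ((n : ℂ) + 1 / 2) ≠ 0 := sub_ne_zero.mpr (by exact_mod_cast hθ n)
    have hadd : θ + Real.pi * ((n : ℂ) + 1 / 2) ≠ 0 := by
      intro h
      apply hθ (-n - 1)
      push_cast
      linear_combination h
    push_cast
    generalize (n : ℂ) + 1 / 2 = a at *
    have h₁ : θ / Real.pi - a = (θ - Real.pi * a) / Real.pi := by field_simp
    have h₂ : θ / Real.pi + a = (θ + Real.pi * a) / Real.pi := by field_simp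
    have h₃ : (Real.pi : ℂ) ^ 2 * a ^ 2 - θ ^ 2 =
      -((θ - Real.pi * a) * (θ + Real.pi * a)) := by ring
    rw [h₁, h₂, h₃]
    field_simp
    ring
  · push_cast
    field_simp
    ring
end

section
/- For every γ : [0,1] → ℝ absolutely continuous with γ(0) = 0, γ(1) = 0, ∫₀¹ cos(γ(t)) dt = 0 and ∫₀¹ sin(γ(t)) dt = 0, one has (1/2)∫₀¹ |γ'(t)|² dt ≥ 2π². -/
open MeasureTheory

/-- Post-composition with a Lipschitz map preserves absolute continuity on an interval. -/
theorem LipschitzWith.comp_absolutelyContinuousOnInterval {X Y : Type*} [PseudoMetricSpace X]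
    [PseudoMetricSpace Y] {K : NNReal} {φ : X → Y} (hφ : LipschitzWith K φ) {f : ℝ → X} {a b : ℝ}
    (hf : AbsolutelyContinuousOnInterval f a b) :
    AbsolutelyContinuousOnInterval (fun t => φ (f t)) a b := by
  have hK : Filter.Tendsto _ _ _ := Filter.Tendsto.const_mul (K : ℝ) hf
  rw [mul_zero] at hK
  refine squeeze_zero (fun _ => Finset.sum_nonneg fun _ _ => dist_nonneg) (fun E => ?_) hK
  rw [Finset.mul_sum]
  exact Finset.sum_le_sum fun i _ => hφ.dist_le_mul _ _

/-- The chain rule and the fundamental theorem of calculus for a Lipschitz differentiable function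
of an absolutely continuous one. -/
theorem AbsolutelyContinuousOnInterval.integral_deriv_comp_mul {h p φ φ' : ℝ → ℝ} {a b : ℝ}
    {K : NNReal} (hh : AbsolutelyContinuousOnInterval h a b)
    (hp : ∀ᵐ t, t ∈ Set.uIcc a b → HasDerivAt h (p t) t)
    (hφ : LipschitzWith K φ) (hφ' : ∀ x, HasDerivAt φ (φ' x) x) :
    ∫ t in a..b, φ' (h t) * p t = φ (h b) - φ (h a) := by
  rw [← (hφ.comp_absolutelyContinuousOnInterval hh).integral_deriv_eq_sub]
  refine intervalIntegral.integral_congr_ae ?_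
  filter_upwards [hp] with t ht hmem
  exact ((hφ' (h t)).comp t (ht (Set.uIoc_subset_uIcc hmem))).deriv.symm

theorem IntervalIntegrable.complex_ofReal {f : ℝ → ℝ} {a b : ℝ} {μ : Measure ℝ}
    (hf : IntervalIntegrable f μ a b) : IntervalIntegrable (fun t => (f t : ℂ)) μ a b :=
  ⟨hf.1.ofReal, hf.2.ofReal⟩

theorem Complex.integral_exp_ofReal_mul_I {p h : ℝ → ℝ} {a b : ℝ}
    (hp : IntervalIntegrable p volume a b) (hh : ContinuousOn h (Set.uIcc a b)) :
    ∫ t in a..b, (p t : ℂ) * Complex.exp (h t * Complex.I) =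
      ((∫ t in a..b, Real.cos (h t) * p t : ℝ) : ℂ) +
        ((∫ t in a..b, Real.sin (h t) * p t : ℝ) : ℂ) * Complex.I := by
  rw [← intervalIntegral.integral_ofReal, ← intervalIntegral.integral_ofReal,
    ← intervalIntegral.integral_mul_const, ← intervalIntegral.integral_add]
  · refine intervalIntegral.integral_congr fun t _ => ?_
    simp only [Complex.exp_mul_I]
    push_cast
    ring
  · exact (hp.continuousOn_mul (Real.continuous_cos.comp_continuousOn hh)).complex_ofReal
  · exact (hp.continuousOn_mul (Real.continuous_sin.comp_continuousOn hh)).complex_ofReal.mul_const _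

/-- The integral of `p * exp (i h)` vanishes when `p` is the derivative of `h` almost everywhere and `exp (i h)` takes
the same value at both endpoints. -/
theorem AbsolutelyContinuousOnInterval.integral_mul_exp_eq_zero {h p : ℝ → ℝ} {a b : ℝ}
    (hh : AbsolutelyContinuousOnInterval h a b) (hpi : IntervalIntegrable p volume a b)
    (hp : ∀ᵐ t, t ∈ Set.uIcc a b → HasDerivAt h (p t) t)
    (hcos : Real.cos (h a) = Real.cos (h b)) (hsin : Real.sin (h a) = Real.sin (h b)) :
    ∫ t in a..b, (p t : ℂ) * Complex.exp (h t * Complex.I) = 0 := by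
  rw [Complex.integral_exp_ofReal_mul_I hpi hh.continuousOn,
    hh.integral_deriv_comp_mul hp Real.lipschitzWith_sin Real.hasDerivAt_sin, hsin]
  have := hh.integral_deriv_comp_mul hp Real.lipschitzWith_cos Real.hasDerivAt_cos
  simp only [neg_mul, intervalIntegral.integral_neg, hcos, sub_self, neg_eq_zero] at this
  simp [this]

theorem fourierCoeffOn_zero_one_mul_exp (q h : ℝ → ℝ) (n : ℤ) :
    fourierCoeffOn zero_lt_one (fun t => (q t : ℂ) * Complex.exp (h t * Complex.I)) n =
      ∫ t in (0:ℝ)..1, (q t : ℂ) *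
        Complex.exp (((h t - 2 * Real.pi * n * t : ℝ) : ℂ) * Complex.I) := by
  rw [fourierCoeffOn_eq_integral]
  simp only [sub_zero, div_one, one_smul]
  refine intervalIntegral.integral_congr fun t _ => ?_
  simp only [fourier_coe_apply, smul_eq_mul]
  rw [mul_left_comm, ← Complex.exp_add]
  congr 2
  push_cast
  ring

/-- The Fourier coefficients of `p * exp (i h)`, where `p` is the derivative of `h`, and of `exp (i h)` are proportional. -/
theorem AbsolutelyContinuousOnInterval.fourierCoeffOn_mul_exp {h p : ℝ → ℝ}
    (hh : AbsolutelyContinuousOnInterval h 0 1) (hpi : IntervalIntegrable p volume 0 1)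
    (hp : ∀ᵐ t, t ∈ Set.uIcc (0:ℝ) 1 → HasDerivAt h (p t) t) (hper : h 0 = h 1) (n : ℤ) :
    fourierCoeffOn zero_lt_one (fun t => (p t : ℂ) * Complex.exp (h t * Complex.I)) n =
      2 * Real.pi * n *
        fourierCoeffOn zero_lt_one (fun t => ((1 : ℝ) : ℂ) * Complex.exp (h t * Complex.I)) n := by
  have hlin : AbsolutelyContinuousOnInterval (fun t : ℝ => 2 * Real.pi * n * t) 0 1 :=
    ContDiffOn.absolutelyContinuousOnInterval (by fun_prop)
  have hac := hh.fun_sub hlin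
  have key := hac.integral_mul_exp_eq_zero (p := fun t => p t - 2 * Real.pi * n)
    (hpi.sub intervalIntegrable_const)
    (by
      filter_upwards [hp] with t ht hmem
      simpa using (ht hmem).fun_sub ((hasDerivAt_id t).const_mul (2 * Real.pi * n)))
    (by
      rw [hper]
      convert (Real.cos_sub_int_mul_two_pi (h 1) n).symm using 2 <;> ring_nf)
    (by
      rw [hper]
      convert (Real.sin_sub_int_mul_two_pi (h 1) n).symm using 2 <;> ring_nf)
  have hexp : ContinuousOn
      (fun t : ℝ => Complex.exp (((h t - 2 * Real.pi * n * t : ℝ) : ℂ) * Complex.I))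
      (Set.uIcc 0 1) := by
    have := Complex.continuous_ofReal.comp_continuousOn hac.continuousOn
    exact (this.mul continuousOn_const).cexp
  rw [fourierCoeffOn_zero_one_mul_exp p h n, fourierCoeffOn_zero_one_mul_exp (fun _ => 1) h n,
    ← intervalIntegral.integral_const_mul, ← sub_eq_zero, ← intervalIntegral.integral_sub, ← key]
  · refine intervalIntegral.integral_congr fun t _ => ?_
    push_cast
    ring
  · exact IntervalIntegrable.mul_continuousOn hpi.complex_ofReal hexp
  · exact ((continuousOn_const.mul hexp).const_mul _).intervalIntegrable

/-- Parseval's identity on `[0, 1]` for a function of modulus `|q|`. -/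
theorem hasSum_sq_fourierCoeffOn_mul_exp {q h : ℝ → ℝ} (hh : ContinuousOn h (Set.uIcc 0 1))
    (hq : IntervalIntegrable q volume 0 1)
    (hq2 : IntervalIntegrable (fun t => q t ^ 2) volume 0 1) :
    HasSum (fun n : ℤ => ‖fourierCoeffOn zero_lt_one
      (fun t => (q t : ℂ) * Complex.exp (h t * Complex.I)) n‖ ^ 2) (∫ t in (0:ℝ)..1, q t ^ 2) := by
  have hexp : ContinuousOn (fun t : ℝ => Complex.exp ((h t : ℂ) * Complex.I)) (Set.uIcc 0 1) :=
    ((Complex.continuous_ofReal.comp_continuousOn hh).mul continuousOn_const).cexp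
  have hint : IntervalIntegrable (fun t => (q t : ℂ) * Complex.exp (h t * Complex.I)) volume 0 1 :=
    IntervalIntegrable.mul_continuousOn hq.complex_ofReal hexp
  have hL2 : MemLp (fun t => (q t : ℂ) * Complex.exp (h t * Complex.I)) 2
      (volume.restrict (Set.Ioc 0 1)) := by
    rw [memLp_two_iff_integrable_sq_norm hint.1.aestronglyMeasurable]
    simpa [Complex.norm_exp_ofReal_mul_I] using! hq2.1
  simpa [Complex.norm_exp_ofReal_mul_I] using hasSum_sq_fourierCoeffOn zero_lt_one hL2

theorem stmt_16 (γ g : ℝ → ℝ)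
    (hg : IntervalIntegrable g volume 0 1)
    (hg2 : IntervalIntegrable (fun s => (g s) ^ 2) volume 0 1)
    (hrep : ∀ t ∈ Set.Icc (0 : ℝ) 1, γ t = ∫ s in (0:ℝ)..t, g s)
    (h0 : γ 0 = 0) (h1 : γ 1 = 0)
    (hcos : (∫ t in (0:ℝ)..1, Real.cos (γ t)) = 0)
    (hsin : (∫ t in (0:ℝ)..1, Real.sin (γ t)) = 0) :
    2 * Real.pi ^ 2 ≤ (1 / 2) * ∫ t in (0:ℝ)..1, (g t) ^ 2 := by
  set h : ℝ → ℝ := fun t => ∫ s in (0:ℝ)..t, g s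
  have hγ : Set.EqOn γ h (Set.uIcc 0 1) := by
    rwa [Set.uIcc_of_le zero_le_one]
  have hac : AbsolutelyContinuousOnInterval h 0 1 :=
    hg.absolutelyContinuousOnInterval_intervalIntegral (by simp)
  have hder : ∀ᵐ t, t ∈ Set.uIcc (0:ℝ) 1 → HasDerivAt h (g t) t := by
    filter_upwards [hg.ae_hasDerivAt_integral] with t ht hmem using ht hmem 0 (by simp)
  have hper : h 0 = h 1 := by
    rw [← hγ (by simp), ← hγ (by simp), h0, h1]
  rw [intervalIntegral.integral_congr (g := fun t => Real.cos (h t) * 1)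
    fun t ht => by simp [hγ ht]] at hcos
  rw [intervalIntegral.integral_congr (g := fun t => Real.sin (h t) * 1)
    fun t ht => by simp [hγ ht]] at hsin
  have hmean : fourierCoeffOn zero_lt_one
      (fun t => ((1 : ℝ) : ℂ) * Complex.exp (h t * Complex.I)) 0 = 0 := by
    rw [fourierCoeffOn_zero_one_mul_exp (fun _ => 1) h 0]
    simp only [Int.cast_zero, mul_zero, zero_mul, sub_zero]
    rw [Complex.integral_exp_ofReal_mul_I (p := fun _ => 1) intervalIntegrable_const
      hac.continuousOn, hcos, hsin]
    simp
  have hparseval := hasSum_sq_fourierCoeffOn_mul_exp hac.continuousOn hg hg2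
  have hone := (hasSum_sq_fourierCoeffOn_mul_exp (q := fun _ => 1) hac.continuousOn
    intervalIntegrable_const intervalIntegrable_const).mul_left (4 * Real.pi ^ 2)
  have hle := hasSum_le (fun n : ℤ => ?_) hone hparseval
  · simp only [one_pow, intervalIntegral.integral_const, sub_zero, smul_eq_mul, mul_one] at hle
    linarith
  · rw [hac.fourierCoeffOn_mul_exp hg hder hper n]
    rcases eq_or_ne n 0 with rfl | hn
    · rw [hmean]
      simp
    · have hn1 : (1 : ℝ) ≤ (n : ℝ) ^ 2 := by
        exact_mod_cast Int.add_one_le_iff.mpr (sq_pos_of_ne_zero hn)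
      simp only [norm_mul, mul_pow, Complex.norm_real, Complex.norm_intCast, Real.norm_eq_abs,
        sq_abs, Complex.norm_ofNat]
      refine mul_le_mul_of_nonneg_right ?_ (sq_nonneg _)
      nlinarith [mul_le_mul_of_nonneg_left hn1 (sq_nonneg Real.pi)]
end
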